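/- Let X be a nontrivial separable Banach space and p ∈ [1,+∞). Then E(X,p) is not Borel reducible to ℝ^ℕ/c₀, and ℝ^ℕ/c₀ is not Borel reducible to E(X,p). -/

import Mathlib

open Filter Topology MeasureTheory
open scoped ENNReal NNReal

noncomputable section

/-- `E` is Borel reducible to `F`: there is a Borel (measurable) map `θ` such that
`E x y ↔ F (θ x) (θ y)` for all `x, y`. -/
def BorelReducible {α β : Type*} [MeasurableSpace α] [MeasurableSpace β]
    (E : α → α → Prop) (F : β → β → Prop) : Prop :=
  ∃ θ : α → β, Measurable θ ∧ ∀ x y, E x y ↔ F (θ x) (θ y)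

/-- overwrite the first `L` coordinates of `z` by those of `s` -/
def splice (L : ℕ) (s z : ℕ → ℕ) : ℕ → ℕ := fun n => if n < L then s n else z n

lemma exists_cyl {U : Set (ℕ → ℕ)} (hU : IsOpen U) {z : ℕ → ℕ} (hz : z ∈ U) :
    ∃ N, ∀ y : ℕ → ℕ, (∀ n < N, y n = z n) → y ∈ U := by
  obtain ⟨I, u, hu, hsub⟩ := isOpen_pi_iff.1 hU z hz
  refine ⟨I.sup id + 1, fun y hy => hsub ?_⟩
  intro i hi
  have : i ≤ I.sup id := Finset.le_sup (f := id) hi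
  rw [hy i (by omega)]
  exact (hu i hi).2

lemma isOpen_cyl (z : ℕ → ℕ) (N : ℕ) : IsOpen {y : ℕ → ℕ | ∀ n < N, y n = z n} := by
  have : {y : ℕ → ℕ | ∀ n < N, y n = z n} = ⋂ n ∈ Finset.range N, (fun y : ℕ → ℕ => y n) ⁻¹' {z n} := by
    ext y; simp
  rw [this]
  exact isOpen_biInter_finset fun n _ => (isOpen_discrete _).preimage (continuous_apply n)

lemma splice_continuous (L : ℕ) (s : ℕ → ℕ) : Continuous (splice L s) := by
  refine continuous_pi fun n => ?_
  unfold splice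
  by_cases h : n < L
  · simp only [h, if_true]; exact continuous_const
  · simp only [h, if_false]; exact continuous_apply n

lemma splice_open (L : ℕ) (s : ℕ → ℕ) : IsOpenMap (splice L s) := by
  intro U hU
  rw [isOpen_iff_mem_nhds]
  rintro _ ⟨z, hz, rfl⟩
  obtain ⟨N, hN⟩ := exists_cyl hU hz
  refine Filter.mem_of_superset ((isOpen_cyl (splice L s z) (max L N)).mem_nhds (by simp)) ?_
  intro y hy
  refine ⟨splice L z y, hN _ ?_, ?_⟩
  · intro n hn
    have := hy n (lt_of_lt_of_le hn (le_max_right _ _))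
    unfold splice at *
    by_cases h : n < L <;> simp_all
  · funext n
    by_cases h : n < L
    · have := hy n (lt_of_lt_of_le h (le_max_left _ _))
      simp only [splice, h, if_true] at *
      exact this.symm
    · simp [splice, h]

lemma exists_residual_continuousOn {Y : Type*} [TopologicalSpace Y] [SecondCountableTopology Y]
    [MeasurableSpace Y] [OpensMeasurableSpace Y] (Θ : (ℕ → ℕ) → Y) (hΘ : Measurable Θ) :
    ∃ G ∈ residual (ℕ → ℕ), ContinuousOn Θ G := by
  classical
  have hB := TopologicalSpace.isBasis_countableBasis Y
  have hcount := TopologicalSpace.countable_countableBasis Y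
  have h1 : ∀ b ∈ TopologicalSpace.countableBasis Y, ∃ u : Set (ℕ → ℕ), IsOpen u ∧
      ∀ᶠ x in residual (ℕ → ℕ), (x ∈ Θ ⁻¹' b ↔ x ∈ u) := by
    intro b hb
    obtain ⟨u, hu, h⟩ := (hΘ (hB.isOpen hb).measurableSet).residualEq_isOpen
    refine ⟨u, hu, ?_⟩
    filter_upwards [h] with x hx
    exact iff_of_eq hx
  choose! u hu hres using h1
  refine ⟨{x | ∀ b ∈ TopologicalSpace.countableBasis Y, (x ∈ Θ ⁻¹' b ↔ x ∈ u b)},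
    (eventually_countable_ball hcount).2 hres, ?_⟩
  rw [continuousOn_iff]
  intro x hx t ht hxt
  obtain ⟨b, hb, hxb, hbt⟩ := hB.exists_subset_of_mem_open hxt ht
  refine ⟨u b, hu b hb, (hx b hb).1 hxb, ?_⟩
  rintro y ⟨hy, hyG⟩
  exact hbt ((hyG b hb).2 hy)

lemma step {Y : Type*} [TopologicalSpace Y]
    (Θ : (ℕ → ℕ) → Y) (ρ : ℕ → ℕ → Y → Y → ℝ)
    (hρc : ∀ m M, Continuous fun q : Y × Y => ρ m M q.1 q.2)
    (hself : ∀ m M y, ρ m M y y = 0)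
    (hsymm : ∀ m M y z, ρ m M y z = ρ m M z y)
    (htri : ∀ m M x y z, ρ m M x z ≤ ρ m M x y + ρ m M y z)
    (H : ∀ x y : ℕ → ℕ, (∃ L, ∀ n, L ≤ n → x n = y n) → ∀ ε > 0, ∃ m₀, ∀ m ≥ m₀, ∀ M ≥ m,
      ρ m M (Θ x) (Θ y) ≤ ε)
    {G : Set (ℕ → ℕ)} (hG : G ∈ residual (ℕ → ℕ)) (hc : ContinuousOn Θ G)
    {D : Set (ℕ → ℕ)} (hD : IsOpen D) (hGD : G ⊆ D) (ε : ℝ) (hε : 0 < ε)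
    (L : ℕ) (S : Finset (ℕ → ℕ)) (mp : ℕ) :
    ∃ (L' : ℕ) (t : ℕ → ℕ) (m : ℕ), L ≤ L' ∧ mp < m ∧
      (∀ z, (∀ n, L ≤ n → n < L' → z n = t n) → ∀ s ∈ S, splice L s z ∈ D) ∧
      (∀ z, (∀ n, L ≤ n → n < L' → z n = t n) → ∀ s ∈ S, ∀ s' ∈ S, (splice L s z) ∈ G →
        splice L s' z ∈ G → ∀ M ≥ m,
          ρ m M (Θ (splice L s z)) (Θ (splice L s' z)) ≤ ε) ∧
      (∀ z z', (∀ n, L ≤ n → n < L' → z n = t n) → (∀ n, L ≤ n → n < L' → z' n = t n) →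
        ∀ s ∈ S, splice L s z ∈ G → splice L s z' ∈ G →
          ρ mp m (Θ (splice L s z)) (Θ (splice L s z')) ≤ ε) := by
  classical
  set W : Set (ℕ → ℕ) := {z | ∀ s ∈ S, splice L s z ∈ G} with hW
  have hWres : W ∈ residual (ℕ → ℕ) :=
    (Filter.eventually_all_finset S).2 fun s _ =>
      (tendsto_residual_of_isOpenMap (splice_continuous L s) (splice_open L s)) hG
  let C : ℕ → Set (ℕ → ℕ) := fun m => {z | ∀ s ∈ S, ∀ s' ∈ S, ∀ M ≥ m,
    ρ m M (Θ (splice L s z)) (Θ (splice L s' z)) ≤ ε}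
  obtain ⟨T, hTW, hTG, hTd⟩ := mem_residual.1 hWres
  have hcover : T ⊆ ⋃ i : ℕ, closure (C (mp + 1 + i) ∩ W) := by
    intro z hz
    have : ∀ s s' : ℕ → ℕ, ∃ m₀, ∀ m ≥ m₀, ∀ M ≥ m,
        ρ m M (Θ (splice L s z)) (Θ (splice L s' z)) ≤ ε := fun s s' =>
      H _ _ ⟨L, fun n hn => by simp [splice, not_lt.2 hn]⟩ ε hε
    choose m₀ hm₀ using this
    let K := S.sup fun s => S.sup fun s' => m₀ s s'
    refine Set.mem_iUnion.2 ⟨K, subset_closure ⟨?_, hTW hz⟩⟩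
    intro s hs s' hs' M hM
    refine hm₀ s s' _ ?_ M hM
    have h1 : m₀ s s' ≤ S.sup fun s' => m₀ s s' := Finset.le_sup (f := fun s' => m₀ s s') hs'
    have h2 : (S.sup fun s' => m₀ s s') ≤ K :=
      Finset.le_sup (f := fun s => S.sup fun s' => m₀ s s') hs
    omega
  have hdense := hTG.dense_iUnion_interior_of_closed hTd
    (f := fun i : ℕ => closure (C (mp + 1 + i) ∩ W)) (fun _ => isClosed_closure) hcover
  obtain ⟨z₁, hz₁⟩ := hdense.nonempty
  obtain ⟨i, hi⟩ := Set.mem_iUnion.1 hz₁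
  set m := mp + 1 + i with hm
  have hVW : ∀ z ∈ interior (closure (C m ∩ W)), ∀ s ∈ S, ∀ s' ∈ S, splice L s z ∈ G →
      splice L s' z ∈ G → ∀ M ≥ m, ρ m M (Θ (splice L s z)) (Θ (splice L s' z)) ≤ ε := by
    intro z hz s hs s' hs' hzs hzs' M hM
    have hcl : z ∈ closure (C m ∩ W) := interior_subset hz
    have hcs : ∀ s ∈ S, splice L s z ∈ G →
        ContinuousWithinAt (fun z => Θ (splice L s z)) (C m ∩ W) z := fun s hs h =>
      (hc _ h).comp (splice_continuous L s).continuousWithinAt (fun y hy => hy.2 s hs)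
    have hcont : ContinuousWithinAt
        (fun z => ρ m M (Θ (splice L s z)) (Θ (splice L s' z))) (C m ∩ W) z :=
      (hρc m M).continuousAt.comp_continuousWithinAt ((hcs s hs hzs).prodMk (hcs s' hs' hzs'))
    have hmem := hcont.mem_closure_image hcl
    have : closure ((fun z => ρ m M (Θ (splice L s z)) (Θ (splice L s' z))) '' (C m ∩ W))
        ⊆ Set.Iic ε := by
      refine closure_minimal ?_ isClosed_Iic
      rintro _ ⟨y, hy, rfl⟩
      exact hy.1 s hs s' hs' M hM
    exact this hmem
  obtain ⟨z₀, hz₀V, hz₀W⟩ := (dense_of_mem_residual hWres).inter_open_nonempty _ isOpen_interior ⟨z₁, hi⟩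
  -- neighbourhoods
  have hev : ∀ᶠ z in 𝓝 z₀, z ∈ interior (closure (C m ∩ W)) ∧ (∀ s ∈ S, splice L s z ∈ D) ∧
      ∀ s ∈ S, splice L s z ∈ G → ρ mp m (Θ (splice L s z₀)) (Θ (splice L s z)) ≤ ε / 2 := by
    refine Filter.Eventually.and (isOpen_interior.mem_nhds hz₀V) (Filter.Eventually.and ?_ ?_)
    · refine (Filter.eventually_all_finset S).2 fun s hs => ?_
      exact (hD.preimage (splice_continuous L s)).mem_nhds (hGD (hz₀W s hs))
    · refine (Filter.eventually_all_finset S).2 fun s hs => ?_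
      have h1 : ContinuousWithinAt (fun y => ρ mp m (Θ (splice L s z₀)) (Θ y)) G (splice L s z₀) := by
        have h2 := (continuousWithinAt_const (s := G) (x := splice L s z₀) (b := Θ (splice L s z₀))).prodMk (hc _ (hz₀W s hs))
        exact (hρc mp m).continuousAt.comp_continuousWithinAt h2
      have h3 : ∀ᶠ y in 𝓝[G] (splice L s z₀), ρ mp m (Θ (splice L s z₀)) (Θ y) < ε / 2 := by
        refine h1.eventually (gt_mem_nhds ?_)
        simp only [hself]; linarith
      have h4 := (eventually_nhdsWithin_iff.1 h3)
      filter_upwards [(splice_continuous L s).continuousAt.eventually h4] with z hz hzG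
      exact (hz hzG).le
  obtain ⟨U, hUsub, hUo, hzU⟩ := mem_nhds_iff.1 hev
  obtain ⟨N, hN⟩ := exists_cyl hUo hzU
  have hss : ∀ s z, splice L s (splice L z₀ z) = splice L s z := by
    intro s z; funext n; unfold splice; split_ifs <;> rfl
  have key : ∀ z, (∀ n, L ≤ n → n < max L N → z n = z₀ n) → splice L z₀ z ∈ U := by
    intro z hz
    apply hN
    intro n hn
    unfold splice
    split_ifs with h
    · rfl
    · exact hz n (by omega) (by omega)
  refine ⟨max L N, z₀, m, le_max_left _ _, by omega, ?_, ?_, ?_⟩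
  · intro z hz s hs
    have := (hUsub (key z hz)).2.1 s hs
    rwa [hss] at this
  · intro z hz s hs s' hs' h1 h2 M hM
    have h1 := hVW _ (hUsub (key z hz)).1 s hs s' hs' (by rwa [hss]) (by rwa [hss]) M hM
    rwa [hss, hss] at h1
  · intro z z' hz hz' s hs hG1 hG2
    have h1 := (hUsub (key z hz)).2.2 s hs (by rwa [hss])
    have h2 := (hUsub (key z' hz')).2.2 s hs (by rwa [hss])
    rw [hss] at h1 h2
    have h3 := htri mp m (Θ (splice L s z)) (Θ (splice L s z₀)) (Θ (splice L s z'))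
    rw [hsymm mp m (Θ (splice L s z)) (Θ (splice L s z₀))] at h3
    linarith

/-- extension of a finite string -/
def extStr (L L' : ℕ) (t s : ℕ → ℕ) (v : ℕ) : ℕ → ℕ := fun n =>
  if n < L then s n else if n < L' then t n else if n = L' then v else 0

lemma generic {Y : Type*} [TopologicalSpace Y] [SecondCountableTopology Y]
    [MeasurableSpace Y] [OpensMeasurableSpace Y]
    (Θ : (ℕ → ℕ) → Y) (hΘ : Measurable Θ) (ρ : ℕ → ℕ → Y → Y → ℝ)
    (hρc : ∀ m M, Continuous fun q : Y × Y => ρ m M q.1 q.2)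
    (hself : ∀ m M y, ρ m M y y = 0)
    (hsymm : ∀ m M y z, ρ m M y z = ρ m M z y)
    (htri : ∀ m M x y z, ρ m M x z ≤ ρ m M x y + ρ m M y z)
    (H : ∀ x y : ℕ → ℕ, (∃ L, ∀ n, L ≤ n → x n = y n) → ∀ ε > 0, ∃ m₀, ∀ m ≥ m₀, ∀ M ≥ m,
      ρ m M (Θ x) (Θ y) ≤ ε)
    (V : ℕ → Finset ℕ) :
    ∃ (m n : ℕ → ℕ) (ξ : (ℕ → ℕ) → ℕ → ℕ), StrictMono m ∧ StrictMono n ∧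
      (∀ a j, ξ a (n j) = a j) ∧ (∀ a b k, k ∉ Set.range n → ξ a k = ξ b k) ∧
      ∀ a b, (∀ j, a j ∈ V j) → (∀ j, b j ∈ V j) → ∀ j, a j = b j →
        ρ (m j) (m (j + 1)) (Θ (ξ a)) (Θ (ξ b)) ≤ (1 / 2) ^ j := by
  classical
  obtain ⟨G₀, hG₀, hcG₀⟩ := exists_residual_continuousOn Θ hΘ
  obtain ⟨G, hGG₀, hGδ, hGd⟩ := mem_residual.1 hG₀
  have hG : G ∈ residual (ℕ → ℕ) := residual_of_dense_Gδ hGδ hGd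
  have hc : ContinuousOn Θ G := hcG₀.mono hGG₀
  obtain ⟨D, hD, hGD⟩ := hGδ.eq_iInter_nat
  have hGDj : ∀ j, G ⊆ D j := fun j => by rw [hGD]; exact Set.iInter_subset _ j
  have hstep := fun (j : ℕ) => step Θ ρ hρc hself hsymm htri H hG hc (hD j) (hGDj j)
    ((1 / 2 : ℝ) ^ (j + 1)) (by positivity)
  choose fL ft fm h1 h2 h3 h4 h5 using hstep
  -- the states
  let nxt : ℕ → ℕ × Finset (ℕ → ℕ) × ℕ → ℕ × Finset (ℕ → ℕ) × ℕ := fun j st =>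
    (fL j st.1 st.2.1 st.2.2 + 1,
      (st.2.1 ×ˢ V j).image
        (fun q => extStr st.1 (fL j st.1 st.2.1 st.2.2) (ft j st.1 st.2.1 st.2.2) q.1 q.2),
      fm j st.1 st.2.1 st.2.2)
  let st : ℕ → ℕ × Finset (ℕ → ℕ) × ℕ := fun j => Nat.rec (0, {fun _ => 0}, 0) nxt j
  have hst : ∀ j, st (j + 1) = nxt j (st j) := fun j => rfl
  let Lj : ℕ → ℕ := fun j => (st j).1
  let Sj : ℕ → Finset (ℕ → ℕ) := fun j => (st j).2.1
  let mj : ℕ → ℕ := fun j => (st j).2.2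
  let nj : ℕ → ℕ := fun j => fL j (Lj j) (Sj j) (mj j)
  let tj : ℕ → ℕ → ℕ := fun j => ft j (Lj j) (Sj j) (mj j)
  have hL1 : ∀ j, Lj (j + 1) = nj j + 1 := fun j => rfl
  have hS1 : ∀ j, Sj (j + 1) =
    (Sj j ×ˢ V j).image (fun q => extStr (Lj j) (nj j) (tj j) q.1 q.2) := fun j => rfl
  have hm1 : ∀ j, mj (j + 1) = fm j (Lj j) (Sj j) (mj j) := fun j => rfl
  have hLn : ∀ j, Lj j ≤ nj j := fun j => h1 j _ _ _
  have hmlt : ∀ j, mj j < mj (j + 1) := fun j => h2 j _ _ _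
  have hA := fun j => h3 j (Lj j) (Sj j) (mj j)
  have hB := fun j => h4 j (Lj j) (Sj j) (mj j)
  have hC := fun j => h5 j (Lj j) (Sj j) (mj j)
  have hLmono : StrictMono Lj := strictMono_nat_of_lt_succ fun j => by
    have := hLn j; rw [hL1]; omega
  have hnmono : StrictMono nj := strictMono_nat_of_lt_succ fun j => by
    have := hLn (j + 1); rw [hL1] at this; omega
  have hmmono : StrictMono mj := strictMono_nat_of_lt_succ hmlt
  -- the strings
  let u : ℕ → (ℕ → ℕ) → ℕ → ℕ := fun j a =>
    Nat.rec (fun _ => 0) (fun j s => extStr (Lj j) (nj j) (tj j) s (a j)) j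
  have hu0 : ∀ a, u 0 a = fun _ => 0 := fun a => rfl
  have hu : ∀ j a, u (j + 1) a = extStr (Lj j) (nj j) (tj j) (u j a) (a j) := fun j a => rfl
  have huS : ∀ a, (∀ j, a j ∈ V j) → ∀ j, u j a ∈ Sj j := by
    intro a ha j
    induction j with
    | zero => rw [hu0]; exact Finset.mem_singleton_self _
    | succ j ih =>
      rw [hu, hS1]
      exact Finset.mem_image.2 ⟨(u j a, a j), Finset.mem_product.2 ⟨ih, ha j⟩, rfl⟩
  have hucong : ∀ a b j, (∀ i < j, a i = b i) → u j a = u j b := by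
    intro a b j
    induction j with
    | zero => intro _; rfl
    | succ j ih =>
      intro h
      rw [hu, hu, ih (fun i hi => h i (by omega)), h j (by omega)]
  have hustab : ∀ a j k n, j ≤ k → n < Lj j → u k a n = u j a n := by
    intro a j k n hjk hn
    induction k, hjk using Nat.le_induction with
    | base => rfl
    | succ k hjk ih =>
      rw [hu, ← ih]
      have : n < Lj k := lt_of_lt_of_le hn (hLmono.monotone hjk)
      simp [extStr, this]
  let ξ : (ℕ → ℕ) → ℕ → ℕ := fun a n => u (n + 1) a n
  have hLge : ∀ j, j ≤ Lj j := fun j => hLmono.id_le j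
  have hξ : ∀ a j n, n < Lj j → ξ a n = u j a n := by
    intro a j n hn
    have h0 : n < Lj (n + 1) := lt_of_lt_of_le (Nat.lt_succ_self n) (hLge _)
    rcases le_total j (n + 1) with h | h
    · exact hustab a j (n + 1) n h hn
    · exact (hustab a (n + 1) j n h h0).symm
  have hξt : ∀ a j n, Lj j ≤ n → n < nj j → ξ a n = tj j n := by
    intro a j n h h'
    rw [hξ a (j + 1) n (by rw [hL1]; omega), hu]
    simp [extStr, not_lt.2 h, h']
  have hξn : ∀ a j, ξ a (nj j) = a j := by
    intro a j
    rw [hξ a (j + 1) (nj j) (by rw [hL1]; omega), hu]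
    simp [extStr, not_lt.2 (hLn j)]
  have hune : ∀ a b j n, n ∉ Set.range nj → u j a n = u j b n := by
    intro a b j n hn
    induction j with
    | zero => rfl
    | succ j ih =>
      have : n ≠ nj j := fun h => hn ⟨j, h.symm⟩
      rw [hu, hu]
      simp [extStr, this, ih]
  have hξne : ∀ a b n, n ∉ Set.range nj → ξ a n = ξ b n := fun a b n hn => hune a b (n + 1) n hn
  have hξspl : ∀ a j, ξ a = splice (Lj j) (u j a) (ξ a) := by
    intro a j; funext n
    unfold splice
    split_ifs with h
    · exact hξ a j n h
    · rfl
  have hξG : ∀ a, (∀ j, a j ∈ V j) → ξ a ∈ G := by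
    intro a ha
    rw [hGD]
    refine Set.mem_iInter.2 fun j => ?_
    rw [hξspl a j]
    exact hA j (ξ a) (hξt a j) (u j a) (huS a ha j)
  have hξtail : ∀ a b j, (∀ i, j ≤ i → a i = b i) → ∀ n, Lj j ≤ n → ξ a n = ξ b n := by
    intro a b j h n hn
    by_cases hr : n ∈ Set.range nj
    · obtain ⟨i, rfl⟩ := hr
      rw [hξn, hξn]
      refine h i ?_
      by_contra hlt
      have : Lj (i + 1) ≤ Lj j := hLmono.monotone (show i + 1 ≤ j by omega)
      rw [hL1] at this
      omega
    · exact hξne a b n hr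
  refine ⟨fun j => mj (j + 1), nj, ξ, fun i j h => hmmono (Nat.succ_lt_succ h), hnmono, hξn, hξne, ?_⟩
  intro a b ha hb j hab
  let c : ℕ → ℕ := fun i => if i ≤ j then a i else b i
  have hcV : ∀ i, c i ∈ V i := by
    intro i; simp only [c]; split_ifs
    · exact ha i
    · exact hb i
  have e1 : ρ (mj (j + 1)) (mj (j + 1 + 1)) (Θ (ξ a)) (Θ (ξ c)) ≤ (1 / 2) ^ (j + 1 + 1) := by
    have huc : u (j + 1) c = u (j + 1) a := hucong c a (j + 1) fun i hi =>
      if_pos (Nat.lt_succ_iff.1 hi)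
    have sa : splice (Lj (j + 1)) (u (j + 1) a) (ξ a) = ξ a := (hξspl a (j + 1)).symm
    have sc : splice (Lj (j + 1)) (u (j + 1) a) (ξ c) = ξ c := by
      rw [← huc]; exact (hξspl c (j + 1)).symm
    have := hC (j + 1) (ξ a) (ξ c) (hξt a (j + 1)) (hξt c (j + 1)) (u (j + 1) a)
      (huS a ha (j + 1)) (by rw [sa]; exact hξG a ha) (by rw [sc]; exact hξG c hcV)
    rwa [sa, sc] at this
  have e2 : ρ (mj (j + 1)) (mj (j + 1 + 1)) (Θ (ξ c)) (Θ (ξ b)) ≤ (1 / 2) ^ (j + 1) := by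
    have hcb : ∀ i, j ≤ i → c i = b i := by
      intro i hi
      simp only [c]
      split_ifs with h
      · obtain rfl : i = j := by omega
        exact hab
      · rfl
    have hspl : splice (Lj j) (u j c) (ξ b) = ξ c := by
      funext n
      unfold splice
      split_ifs with h
      · exact (hξ c j n h).symm
      · exact (hξtail c b j hcb n (by omega)).symm
    have := hB j (ξ b) (hξt b j) (u j c) (huS c hcV j) (u j b) (huS b hb j)
      (by rw [hspl]; exact hξG c hcV) (by rw [← hξspl]; exact hξG b hb) (mj (j + 1 + 1))
      (hmlt (j + 1)).le
    rwa [hspl, ← hξspl] at this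
  have e3 := htri (mj (j + 1)) (mj (j + 1 + 1)) (Θ (ξ a)) (Θ (ξ c)) (Θ (ξ b))
  have hpos : (0 : ℝ) < (1 / 2) ^ j := by positivity
  rw [pow_succ, pow_succ] at e1
  rw [pow_succ] at e2
  simp only
  linarith

/-- block sup distance -/
def rhoSup (m M : ℕ) (y z : ℕ → ℝ) : ℝ :=
  (((Finset.Ico m M).sup fun k => ‖y k - z k‖₊ : ℝ≥0) : ℝ)

lemma rhoSup_le {m M : ℕ} {y z : ℕ → ℝ} {r : ℝ} (hr : 0 ≤ r)
    (h : ∀ k, m ≤ k → k < M → |y k - z k| ≤ r) : rhoSup m M y z ≤ r := by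
  lift r to ℝ≥0 using hr
  unfold rhoSup
  rw [NNReal.coe_le_coe]
  refine Finset.sup_le fun k hk => ?_
  rw [Finset.mem_Ico] at hk
  exact h k hk.1 hk.2

lemma le_rhoSup {m M : ℕ} {y z : ℕ → ℝ} {k : ℕ} (h : m ≤ k) (h' : k < M) :
    |y k - z k| ≤ rhoSup m M y z := by
  have : ‖y k - z k‖₊ ≤ (Finset.Ico m M).sup fun k => ‖y k - z k‖₊ :=
    Finset.le_sup (f := fun k => ‖y k - z k‖₊) (Finset.mem_Ico.2 ⟨h, h'⟩)
  exact this

lemma rhoSup_nonneg (m M : ℕ) (y z : ℕ → ℝ) : 0 ≤ rhoSup m M y z := NNReal.coe_nonneg _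

lemma exists_block {m : ℕ → ℕ} (hm : StrictMono m) {k : ℕ} (hk : m 0 ≤ k) :
    ∃ j, m j ≤ k ∧ k < m (j + 1) := by
  have hex : ∃ j, k < m (j + 1) := ⟨k, lt_of_lt_of_le (Nat.lt_succ_self k) (hm.id_le _)⟩
  classical
  refine ⟨Nat.find hex, ?_, Nat.find_spec hex⟩
  rcases h : Nat.find hex with _ | i
  · exact hk
  · have := Nat.find_min hex (m := i) (by omega)
    omega

lemma summable_indicator_range {φ : ℕ → ℕ} (hφ : StrictMono φ) {w : ℕ → ℝ}
    (hw : Summable fun i => w (φ i)) : Summable ((Set.range φ).indicator w) := by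
  refine (hφ.injective.summable_iff (fun x hx => Set.indicator_of_notMem hx _)).1 ?_
  refine hw.congr fun i => ?_
  simp

lemma partA {X : Type*} [NormedAddCommGroup X] [NormedSpace ℝ X]
    [MeasurableSpace X] [BorelSpace X]
    (hX : ∃ e : X, e ≠ 0) (p : ℝ) (hp : 1 ≤ p) (θ : (ℕ → X) → ℕ → ℝ) (hθ : Measurable θ)
    (hred : ∀ x y : ℕ → X, (Summable fun n => ‖x n - y n‖ ^ p) ↔
      Tendsto (fun n => |θ x n - θ y n|) atTop (𝓝 0)) : False := by
  classical
  have hp0 : 0 < p := by linarith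
  obtain ⟨e₀, he₀⟩ := hX
  obtain ⟨e, he⟩ : ∃ e : X, ‖e‖ = 1 := ⟨(‖e₀‖⁻¹ : ℝ) • e₀, by
    rw [norm_smul, norm_inv, norm_norm, inv_mul_cancel₀ (norm_ne_zero_iff.2 he₀)]⟩
  let q : ℕ → ℝ := fun i => if i = 0 then 0 else (1 / (i : ℝ)) ^ (1 / p)
  let ψ : (ℕ → ℕ) → ℕ → X := fun z n => q (z n) • e
  have hψ : Measurable ψ := by
    refine measurable_pi_lambda _ fun n => ?_
    exact (measurable_of_countable (fun i : ℕ => q i • e)).comp (measurable_pi_apply n)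
  have hqp : ∀ i : ℕ, ‖q i • e - q 0 • e‖ ^ p = if i = 0 then 0 else 1 / (i : ℝ) := by
    intro i
    by_cases hi : i = 0
    · simp [hi, Real.zero_rpow hp0.ne']
    · have h1 : (0 : ℝ) ≤ 1 / (i : ℝ) := by positivity
      simp only [q, hi, if_false, if_true, zero_smul, sub_zero, norm_smul, he, mul_one]
      rw [Real.norm_of_nonneg (by positivity), ← Real.rpow_mul h1, one_div_mul_cancel hp0.ne',
        Real.rpow_one]
  let Θ : (ℕ → ℕ) → ℕ → ℝ := fun z => θ (ψ z)
  have hΘ : Measurable Θ := hθ.comp hψ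
  obtain ⟨m, n, ξ, hm, hn, hξn, hξne, hmain⟩ := generic Θ hΘ rhoSup
    (by
      intro m M
      unfold rhoSup
      refine NNReal.continuous_coe.comp (Continuous.finset_sup_apply fun k _ => ?_)
      fun_prop)
    (by intro m M y; exact le_antisymm (rhoSup_le le_rfl (by simp)) (rhoSup_nonneg _ _ _ _))
    (by
      intro m M y z
      unfold rhoSup
      exact congrArg _ (Finset.sup_congr rfl fun k _ => NNReal.eq (norm_sub_rev (y k) (z k))))
    (by
      intro m M x y z
      refine rhoSup_le (add_nonneg (rhoSup_nonneg _ _ _ _) (rhoSup_nonneg _ _ _ _)) ?_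
      intro k h1 h2
      have a1 := le_rhoSup (y := x) (z := y) h1 h2
      have a2 := le_rhoSup (y := y) (z := z) h1 h2
      have := abs_sub_le (x k) (y k) (z k)
      linarith)
    (by
      rintro x y ⟨L, hL⟩ ε hε
      have hsum : Summable fun n => ‖ψ x n - ψ y n‖ ^ p := by
        refine summable_of_ne_finset_zero (s := Finset.range L) fun k hk => ?_
        have : x k = y k := hL k (by simpa using hk)
        simp [ψ, this, Real.zero_rpow hp0.ne']
      have ht := (hred _ _).1 hsum
      have hev := ht.eventually (gt_mem_nhds hε)
      obtain ⟨m₀, hm₀⟩ := eventually_atTop.1 hev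
      refine ⟨m₀, fun m hm M _ => rhoSup_le hε.le fun k hk _ => (hm₀ k (le_trans hm hk)).le⟩)
    (fun j => {0, j + 1})
  let aT : Set ℕ → ℕ → ℕ := fun T j => if j ∈ T then j + 1 else 0
  have haV : ∀ T j, aT T j ∈ ({0, j + 1} : Finset ℕ) := by
    intro T j; simp only [aT]; split_ifs <;> simp
  let D : Set ℕ → ℕ → ℝ := fun T j => rhoSup (m j) (m (j + 1)) (Θ (ξ (aT T))) (Θ (ξ (aT ∅)))
  have hsumiff : ∀ T : Set ℕ, (Summable fun k => ‖ψ (ξ (aT T)) k - ψ (ξ (aT ∅)) k‖ ^ p) ↔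
      Summable (T.indicator fun j : ℕ => 1 / ((j : ℝ) + 1)) := by
    intro T
    rw [← hn.injective.summable_iff]
    · refine summable_congr fun j => ?_
      simp only [Function.comp, ψ, hξn]
      have h0 : aT ∅ j = 0 := by simp [aT]
      rw [h0, hqp]
      by_cases hj : j ∈ T <;> simp [aT, hj]
    · intro k hk
      simp only [ψ, hξne (aT T) (aT ∅) k hk, sub_self, norm_zero, Real.zero_rpow hp0.ne']
  have hDt : ∀ T, Tendsto (fun k => |Θ (ξ (aT T)) k - Θ (ξ (aT ∅)) k|) atTop (𝓝 0) ↔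
      Tendsto (D T) atTop (𝓝 0) := by
    intro T
    constructor
    · intro h
      rw [Metric.tendsto_atTop] at h ⊢
      intro ε hε
      obtain ⟨N, hN⟩ := h (ε / 2) (by linarith)
      refine ⟨N, fun j hj => ?_⟩
      rw [Real.dist_0_eq_abs, abs_of_nonneg (rhoSup_nonneg _ _ _ _)]
      refine lt_of_le_of_lt (rhoSup_le (r := ε / 2) (by linarith) fun k hk _ => ?_) (by linarith)
      have := hN k (le_trans hj (le_trans (hm.id_le j) hk))
      rw [Real.dist_0_eq_abs, abs_abs] at this
      exact this.le
    · intro h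
      rw [Metric.tendsto_atTop] at h ⊢
      intro ε hε
      obtain ⟨N, hN⟩ := h ε hε
      refine ⟨m N, fun k hk => ?_⟩
      obtain ⟨j, hj, hj'⟩ := exists_block hm (le_trans (hm.monotone (Nat.zero_le N)) hk)
      have hNj : N ≤ j := by
        by_contra hlt
        have := hm.monotone (show j + 1 ≤ N by omega)
        omega
      have h1 := hN j hNj
      rw [Real.dist_0_eq_abs, abs_of_nonneg (rhoSup_nonneg _ _ _ _)] at h1
      rw [Real.dist_0_eq_abs, abs_abs]
      exact lt_of_le_of_lt (le_rhoSup hj hj') h1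
  have htot : ∀ T : Set ℕ, Summable (T.indicator fun j : ℕ => 1 / ((j : ℝ) + 1)) ↔
      Tendsto (D T) atTop (𝓝 0) := fun T =>
    (hsumiff T).symm.trans ((hred _ _).trans (hDt T))
  have hnot : ¬ Tendsto (D Set.univ) atTop (𝓝 0) := by
    rw [← htot, Set.indicator_univ]
    intro h
    have h2 : Summable fun j : ℕ => 1 / (((j + 1 : ℕ) : ℝ)) := by simpa using h
    exact Real.not_summable_one_div_natCast ((summable_nat_add_iff 1).1 h2)
  obtain ⟨ε, hε, hfreq⟩ : ∃ ε > 0, ∃ᶠ j in atTop, ε ≤ D Set.univ j := by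
    by_contra hcon
    push Not at hcon
    apply hnot
    rw [Metric.tendsto_atTop]
    intro ε hε
    obtain ⟨N, hN⟩ := eventually_atTop.1 (hcon ε hε)
    refine ⟨N, fun j hj => ?_⟩
    rw [Real.dist_0_eq_abs, abs_of_nonneg (rhoSup_nonneg _ _ _ _)]
    exact hN j hj
  obtain ⟨φ, hφ, hφP⟩ := extraction_forall_of_frequently
    (P := fun i j => ε ≤ D Set.univ j ∧ 1 / ((j : ℝ) + 1) ≤ (1 / 2) ^ i) (fun i => by
      refine hfreq.and_eventually ?_
      have h1 : Tendsto (fun j : ℕ => 1 / ((j : ℝ) + 1)) atTop (𝓝 0) :=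
        tendsto_one_div_add_atTop_nhds_zero_nat
      exact (h1.eventually (gt_mem_nhds (show (0 : ℝ) < (1 / 2) ^ i by positivity))).mono
        fun _ h => h.le)
  have hT := (htot (Set.range φ)).1 (summable_indicator_range hφ
    (Summable.of_nonneg_of_le (fun i => by positivity) (fun i => (hφP i).2)
      (summable_geometric_of_lt_one (by norm_num) (by norm_num))))
  have hlim : Tendsto (fun i => D (Set.range φ) (φ i) + (1 / 2 : ℝ) ^ (φ i)) atTop (𝓝 (0 + 0)) :=
    (hT.comp hφ.tendsto_atTop).add
      ((tendsto_pow_atTop_nhds_zero_of_lt_one (by norm_num) (by norm_num)).comp hφ.tendsto_atTop)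
  rw [add_zero] at hlim
  obtain ⟨i, hi⟩ := (hlim.eventually (gt_mem_nhds hε)).exists
  have h1 := hmain (aT Set.univ) (aT (Set.range φ)) (haV _) (haV _) (φ i) (by simp [aT])
  have h2 : D Set.univ (φ i) ≤ rhoSup (m (φ i)) (m (φ i + 1)) (Θ (ξ (aT Set.univ)))
      (Θ (ξ (aT (Set.range φ)))) + D (Set.range φ) (φ i) := by
    refine rhoSup_le (add_nonneg (rhoSup_nonneg _ _ _ _) (rhoSup_nonneg _ _ _ _)) ?_
    intro k hk1 hk2
    have a1 := le_rhoSup (y := Θ (ξ (aT Set.univ))) (z := Θ (ξ (aT (Set.range φ)))) hk1 hk2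
    have a2 := le_rhoSup (y := Θ (ξ (aT (Set.range φ)))) (z := Θ (ξ (aT ∅))) hk1 hk2
    have := abs_sub_le (Θ (ξ (aT Set.univ)) k) (Θ (ξ (aT (Set.range φ))) k) (Θ (ξ (aT ∅)) k)
    linarith
  have h3 := (hφP i).1
  linarith

/-- block ℓ^p distance -/
def rhoP {X : Type*} [NormedAddCommGroup X] (p : ℝ) (m M : ℕ) (y z : ℕ → X) : ℝ :=
  (∑ k ∈ Finset.Ico m M, ‖y k - z k‖ ^ p) ^ (1 / p)

lemma sum_blocks {m : ℕ → ℕ} (hm : StrictMono m) (f : ℕ → ℝ) (J : ℕ) :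
    ∑ j ∈ Finset.range J, ∑ k ∈ Finset.Ico (m j) (m (j + 1)), f k =
      ∑ k ∈ Finset.Ico (m 0) (m J), f k := by
  induction J with
  | zero => simp
  | succ J ih =>
    rw [Finset.sum_range_succ, ih, Finset.sum_Ico_consecutive _ (hm.monotone (Nat.zero_le J))
      (hm.monotone (Nat.le_succ J))]

lemma summable_blocks {m : ℕ → ℕ} (hm : StrictMono m) {f : ℕ → ℝ} (hf : ∀ k, 0 ≤ f k) :
    Summable f ↔ Summable fun j => ∑ k ∈ Finset.Ico (m j) (m (j + 1)), f k := by
  constructor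
  · intro h
    refine summable_of_sum_range_le (c := ∑' k, f k)
      (fun j => Finset.sum_nonneg fun k _ => hf k) fun J => ?_
    rw [sum_blocks hm]
    exact h.sum_le_tsum _ (fun k _ => hf k)
  · intro h
    refine summable_of_sum_range_le (c := ∑ k ∈ Finset.range (m 0), f k +
      ∑' j, ∑ k ∈ Finset.Ico (m j) (m (j + 1)), f k) hf fun J => ?_
    have h1 := h.sum_le_tsum (Finset.range J) (fun j _ => Finset.sum_nonneg fun k _ => hf k)
    rw [sum_blocks hm] at h1
    have h2 : ∑ k ∈ Finset.range J, f k ≤ ∑ k ∈ Finset.range (m J), f k :=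
      Finset.sum_le_sum_of_subset_of_nonneg
        (Finset.range_subset_range.2 (hm.id_le J)) (fun k _ _ => hf k)
    rw [← Finset.sum_range_add_sum_Ico _ (hm.monotone (Nat.zero_le J))] at h2
    linarith

section
variable {X : Type*} [NormedAddCommGroup X] {p : ℝ}

lemma rhoP_nonneg (m M : ℕ) (y z : ℕ → X) : 0 ≤ rhoP p m M y z :=
  Real.rpow_nonneg (Finset.sum_nonneg fun _ _ => Real.rpow_nonneg (norm_nonneg _) _) _

lemma rhoP_pow (hp : 1 ≤ p) (m M : ℕ) (y z : ℕ → X) :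
    rhoP p m M y z ^ p = ∑ k ∈ Finset.Ico m M, ‖y k - z k‖ ^ p := by
  unfold rhoP
  rw [← Real.rpow_mul (Finset.sum_nonneg fun _ _ => Real.rpow_nonneg (norm_nonneg _) _),
    one_div_mul_cancel (by linarith), Real.rpow_one]

lemma rhoP_cont (hp : 1 ≤ p) (m M : ℕ) :
    Continuous fun q : (ℕ → X) × (ℕ → X) => rhoP p m M q.1 q.2 := by
  unfold rhoP
  refine Continuous.rpow_const (continuous_finsetSum _ fun k _ => ?_)
    (fun _ => Or.inr (by positivity))
  refine Continuous.rpow_const ?_ (fun _ => Or.inr (by positivity))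
  fun_prop

lemma rhoP_self (hp : 1 ≤ p) (m M : ℕ) (y : ℕ → X) : rhoP p m M y y = 0 := by
  have h : p ≠ 0 := by linarith
  simp [rhoP, Real.zero_rpow h, Real.zero_rpow (inv_ne_zero h)]

lemma rhoP_symm (m M : ℕ) (y z : ℕ → X) : rhoP p m M y z = rhoP p m M z y := by
  unfold rhoP
  congr 1
  exact Finset.sum_congr rfl fun k _ => by rw [norm_sub_rev]

lemma rhoP_tri (hp : 1 ≤ p) (m M : ℕ) (x y z : ℕ → X) :
    rhoP p m M x z ≤ rhoP p m M x y + rhoP p m M y z := by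
  have h := Real.Lp_add_le (Finset.Ico m M) (fun k => ‖x k - y k‖) (fun k => ‖y k - z k‖) hp
  simp only [abs_norm] at h
  refine le_trans ?_ h
  unfold rhoP
  refine Real.rpow_le_rpow
    (Finset.sum_nonneg fun _ _ => Real.rpow_nonneg (norm_nonneg _) _) ?_ (by positivity)
  refine Finset.sum_le_sum fun k _ => ?_
  refine Real.rpow_le_rpow (norm_nonneg _) ?_ (by linarith)
  rw [abs_of_nonneg (by positivity)]
  have := norm_add_le (x k - y k) (y k - z k)
  simpa using this

end

lemma exists_gap (d : ℕ → ℕ → ℝ) (hself : d 0 0 = 0) (htri : ∀ a b c, d a c ≤ d a b + d b c)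
    (N : ℕ) (hN : 0 < N) : ∃ i < N, d 0 N ≤ N * d i (i + 1) := by
  have h1 : ∀ n, d 0 n ≤ ∑ i ∈ Finset.range n, d i (i + 1) := by
    intro n
    induction n with
    | zero => simp [hself]
    | succ n ih =>
      rw [Finset.sum_range_succ]
      have := htri 0 n (n + 1)
      linarith
  by_contra hcon
  push Not at hcon
  have h2 : ∑ i ∈ Finset.range N, (N : ℝ) * d i (i + 1) < ∑ i ∈ Finset.range N, d 0 N :=
    Finset.sum_lt_sum_of_nonempty ⟨0, by simpa using hN⟩
      fun i hi => hcon i (by simpa using hi)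
  rw [← Finset.mul_sum] at h2
  simp only [Finset.sum_const, Finset.card_range, nsmul_eq_mul] at h2
  have h3 : (0 : ℝ) < N := by exact_mod_cast hN
  have := lt_of_mul_lt_mul_left h2 h3.le
  linarith [h1 N]

lemma partB {X : Type*} [NormedAddCommGroup X] [TopologicalSpace.SeparableSpace X]
    [MeasurableSpace X] [BorelSpace X]
    (p : ℝ) (hp : 1 ≤ p) (θ : (ℕ → ℝ) → ℕ → X) (hθ : Measurable θ)
    (hred : ∀ x y : ℕ → ℝ, Tendsto (fun n => |x n - y n|) atTop (𝓝 0) ↔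
      Summable fun n => ‖θ x n - θ y n‖ ^ p) : False := by
  classical
  have hp0 : 0 < p := by linarith
  haveI : SecondCountableTopology X := UniformSpace.secondCountable_of_separable X
  let N : ℕ → ℕ := fun j => ⌊((j : ℝ) + 1) ^ (1 / p)⌋₊
  have hN1 : ∀ j, 0 < N j := by
    intro j
    refine Nat.floor_pos.2 (Real.one_le_rpow ?_ (by positivity))
    have : (0 : ℝ) ≤ j := Nat.cast_nonneg j
    linarith
  have hNr : ∀ j, (0 : ℝ) < N j := fun j => by exact_mod_cast hN1 j
  have hNp : ∀ j, (N j : ℝ) ^ p ≤ (j : ℝ) + 1 := by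
    intro j
    have h0 : (0 : ℝ) ≤ (j : ℝ) + 1 := by positivity
    have h1 : (N j : ℝ) ≤ ((j : ℝ) + 1) ^ (1 / p) := Nat.floor_le (by positivity)
    have h2 := Real.rpow_le_rpow (hNr j).le h1 hp0.le
    rwa [← Real.rpow_mul h0, one_div_mul_cancel hp0.ne', Real.rpow_one] at h2
  have hNle : ∀ j, (N j : ℝ) ≤ (j : ℝ) + 1 := by
    intro j
    refine le_trans ?_ (hNp j)
    have h1 : (1 : ℝ) ≤ N j := by exact_mod_cast hN1 j
    calc (N j : ℝ) = (N j : ℝ) ^ (1 : ℝ) := (Real.rpow_one _).symm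
      _ ≤ _ := Real.rpow_le_rpow_of_exponent_le h1 hp
  have hNt : Tendsto (fun j => (1 : ℝ) / N j) atTop (𝓝 0) := by
    have h1 : Tendsto (fun j : ℕ => ((j : ℝ) + 1) ^ (1 / p)) atTop atTop :=
      (tendsto_rpow_atTop (by positivity)).comp
        (tendsto_atTop_add_const_right _ _ tendsto_natCast_atTop_atTop)
    have h2 : Tendsto N atTop atTop := tendsto_nat_floor_atTop.comp h1
    exact tendsto_const_nhds.div_atTop (tendsto_natCast_atTop_atTop.comp h2)
  let q : ℕ → ℝ := fun i => ((Nat.unpair i).1 : ℝ) / ((Nat.unpair i).2 : ℝ)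
  let ψ : (ℕ → ℕ) → ℕ → ℝ := fun z n => q (z n)
  have hψ : Measurable ψ := by
    refine measurable_pi_lambda _ fun n => ?_
    exact (measurable_of_countable q).comp (measurable_pi_apply n)
  let Θ : (ℕ → ℕ) → ℕ → X := fun z => θ (ψ z)
  have hΘ : Measurable Θ := hθ.comp hψ
  obtain ⟨m, n, ξ, hm, hn, hξn, hξne, hmain⟩ := generic Θ hΘ (rhoP p)
    (rhoP_cont hp) (rhoP_self hp) rhoP_symm (rhoP_tri hp)
    (by
      rintro x y ⟨L, hL⟩ ε hε
      have ht : Tendsto (fun n => |ψ x n - ψ y n|) atTop (𝓝 0) := by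
        refine tendsto_const_nhds.congr' ?_
        filter_upwards [eventually_ge_atTop L] with k hk
        simp [ψ, hL k hk]
      have hs := (hred _ _).1 ht
      have hεp : 0 < ε ^ p := Real.rpow_pos_of_pos hε p
      have hnn : ∀ k, 0 ≤ ‖θ (ψ x) k - θ (ψ y) k‖ ^ p :=
        fun k => Real.rpow_nonneg (norm_nonneg _) _
      have htail := hs.hasSum.tendsto_sum_nat.eventually
        (lt_mem_nhds (sub_lt_self _ hεp))
      obtain ⟨m₀, hm₀⟩ := eventually_atTop.1 htail
      refine ⟨m₀, fun m hm M hM => ?_⟩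
      have h1 := hm₀ m hm
      have h2 := hs.sum_le_tsum (Finset.range M) (fun k _ => hnn k)
      rw [← Finset.sum_range_add_sum_Ico _ hM] at h2
      have h3 : rhoP p m M (Θ x) (Θ y) ^ p ≤ ε ^ p := by
        rw [rhoP_pow hp]
        simp only [Θ]
        linarith
      exact (Real.rpow_le_rpow_iff (rhoP_nonneg _ _ _ _) hε.le hp0).1 h3)
    (fun j => (Finset.range (N j + 1)).image fun i => Nat.pair i (N j))
  let A : (ℕ → ℕ) → ℕ → ℕ := fun f j => Nat.pair (min (f j) (N j)) (N j)
  have hAV : ∀ f j, A f j ∈ (Finset.range (N j + 1)).image fun i => Nat.pair i (N j) := by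
    intro f j
    refine Finset.mem_image.2 ⟨min (f j) (N j), ?_, rfl⟩
    have := min_le_right (f j) (N j)
    rw [Finset.mem_range]; omega
  let D : (ℕ → ℕ) → (ℕ → ℕ) → ℕ → ℝ := fun f g j =>
    rhoP p (m j) (m (j + 1)) (Θ (ξ (A f))) (Θ (ξ (A g)))
  have hD0 : ∀ f g j, 0 ≤ D f g j := fun f g j => rhoP_nonneg _ _ _ _
  have hψn : ∀ f j, ψ (ξ (A f)) (n j) = (min (f j) (N j) : ℕ) / (N j : ℝ) := by
    intro f j
    simp only [ψ, hξn, A, q, Nat.unpair_pair]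
  have htk : ∀ f g, Tendsto (fun k => |ψ (ξ (A f)) k - ψ (ξ (A g)) k|) atTop (𝓝 0) ↔
      Tendsto (fun j => |((min (f j) (N j) : ℕ) : ℝ) / (N j : ℝ) -
        ((min (g j) (N j) : ℕ) : ℝ) / (N j : ℝ)|) atTop (𝓝 0) := by
    intro f g
    constructor
    · intro h
      refine (h.comp hn.tendsto_atTop).congr fun j => ?_
      simp only [Function.comp, hψn]
    · intro h
      rw [Metric.tendsto_atTop] at h ⊢
      intro ε hε
      obtain ⟨J, hJ⟩ := h ε hε
      refine ⟨n J, fun k hk => ?_⟩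
      by_cases hr : k ∈ Set.range n
      · obtain ⟨j, rfl⟩ := hr
        rw [hψn, hψn]
        exact hJ j (hn.le_iff_le.1 hk)
      · simp only [ψ, hξne (A f) (A g) k hr, sub_self, abs_zero, dist_self]
        exact hε
  have hrel : ∀ f g, Tendsto (fun j => |((min (f j) (N j) : ℕ) : ℝ) / (N j : ℝ) -
        ((min (g j) (N j) : ℕ) : ℝ) / (N j : ℝ)|) atTop (𝓝 0) ↔
      Summable fun j => D f g j ^ p := by
    intro f g
    rw [← htk, hred, summable_blocks hm (fun k => Real.rpow_nonneg (norm_nonneg _) _)]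
    simp only [D, rhoP_pow hp, Θ]
  have hloc : ∀ f f' g g' j, f j = f' j → g j = g' j →
      D f g j ≤ D f' g' j + 2 * (1 / 2) ^ j := by
    intro f f' g g' j hf hg
    have h1 := hmain (A f) (A f') (hAV _) (hAV _) j (by simp only [A, hf])
    have h2 := hmain (A g') (A g) (hAV _) (hAV _) j (by simp only [A, hg])
    have h3 := rhoP_tri hp (m j) (m (j + 1)) (Θ (ξ (A f))) (Θ (ξ (A f'))) (Θ (ξ (A g)))
    have h4 := rhoP_tri hp (m j) (m (j + 1)) (Θ (ξ (A f'))) (Θ (ξ (A g'))) (Θ (ξ (A g)))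
    simp only [D]
    linarith
  let d : ℕ → ℕ → ℕ → ℝ := fun j u v => D (fun _ => u) (fun _ => v) j
  have hgap : ∀ j, ∃ i < N j, d j 0 (N j) ≤ N j * d j i (i + 1) := fun j =>
    exists_gap (d j) (rhoP_self hp _ _ _) (fun a b c => rhoP_tri hp _ _ _ _ _) (N j) (hN1 j)
  choose i hiN hid using hgap
  have hsum : Summable fun j => D i (fun j => i j + 1) j ^ p := by
    rw [← hrel]
    refine hNt.congr fun j => ?_
    have h1 := hiN j
    rw [min_eq_left (show i j ≤ N j by omega), min_eq_left (show i j + 1 ≤ N j by omega),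
      ← sub_div, abs_div, abs_of_pos (hNr j)]
    push_cast
    simp
  have hfreq : ∀ δ > 0, ∃ᶠ j in atTop, d j 0 (N j) ≤ δ := by
    intro δ hδ hev
    simp only [not_le] at hev
    have hgeo : Tendsto (fun j : ℕ => ((j : ℝ) + 1) * (2 * (1 / 2 : ℝ) ^ j)) atTop (𝓝 0) := by
      have h1 := tendsto_self_mul_const_pow_of_lt_one (r := (1 / 2 : ℝ)) (by norm_num) (by norm_num)
      have h2 := tendsto_pow_atTop_nhds_zero_of_lt_one (r := (1 / 2 : ℝ)) (by norm_num) (by norm_num)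
      have h3 := (h1.add h2).const_mul 2
      simp only [add_zero, mul_zero] at h3
      refine h3.congr fun j => ?_
      ring
    have hev2 := hgeo.eventually (gt_mem_nhds (half_pos hδ))
    obtain ⟨J, hJ⟩ := eventually_atTop.1 (hev.and hev2)
    have hlow : ∀ j ≥ J, (δ / 2) ^ p * (1 / ((j : ℝ) + 1)) ≤ D i (fun j => i j + 1) j ^ p := by
      intro j hj
      obtain ⟨e1, e2⟩ := hJ j hj
      have e3 := hloc (fun _ => i j) i (fun _ => i j + 1) (fun j => i j + 1) j rfl rfl
      have e4 : N j * d j (i j) (i j + 1) ≤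
          N j * (D i (fun j => i j + 1) j + 2 * (1 / 2) ^ j) :=
        mul_le_mul_of_nonneg_left e3 (hNr j).le
      have e5 : (N j : ℝ) * (2 * (1 / 2) ^ j) ≤ ((j : ℝ) + 1) * (2 * (1 / 2 : ℝ) ^ j) :=
        mul_le_mul_of_nonneg_right (hNle j) (by positivity)
      have e6 : δ / 2 ≤ N j * D i (fun j => i j + 1) j := by
        have := hid j
        rw [mul_add] at e4
        linarith
      have e7 := Real.rpow_le_rpow (half_pos hδ).le e6 hp0.le
      rw [Real.mul_rpow (hNr j).le (hD0 _ _ _)] at e7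
      have hj1 : (0 : ℝ) < (j : ℝ) + 1 := by positivity
      rw [mul_one_div, div_le_iff₀ hj1]
      have e8 := mul_le_mul_of_nonneg_right (hNp j)
        (Real.rpow_nonneg (hD0 i (fun j => i j + 1) j) p)
      linarith
    have hs1 : Summable fun j : ℕ => (δ / 2) ^ p * (1 / ((j : ℝ) + 1)) := by
      refine Summable.of_norm_bounded_eventually_nat hsum ?_
      filter_upwards [eventually_ge_atTop J] with j hj
      rw [Real.norm_of_nonneg (by positivity)]
      exact hlow j hj
    rw [summable_mul_left_iff (Real.rpow_pos_of_pos (half_pos hδ) p).ne'] at hs1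
    have h2 : Summable fun j : ℕ => 1 / (((j + 1 : ℕ) : ℝ)) := by simpa using hs1
    exact Real.not_summable_one_div_natCast ((summable_nat_add_iff 1).1 h2)
  obtain ⟨φ, hφ, hφP⟩ := extraction_forall_of_frequently
    (P := fun i j => d j 0 (N j) ≤ (1 / 2) ^ i) (fun i => hfreq _ (by positivity))
  let fT : ℕ → ℕ := fun j => if j ∈ Set.range φ then N j else 0
  let r : ℕ → ℝ := fun j => (Set.range φ).indicator (fun j => d j 0 (N j)) j + 2 * (1 / 2) ^ j
  have hr : Summable r := by
    have hg : Summable fun i : ℕ => (1 / 2 : ℝ) ^ i :=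
      summable_geometric_of_lt_one (by norm_num) (by norm_num)
    refine Summable.add ?_ (hg.mul_left 2)
    exact summable_indicator_range hφ (Summable.of_nonneg_of_le (fun i => hD0 _ _ _) hφP hg)
  have hDr : ∀ j, D (fun _ => 0) fT j ≤ r j := by
    intro j
    by_cases hj : j ∈ Set.range φ
    · have := hloc (fun _ => 0) (fun _ => 0) fT (fun _ => N j) j rfl (if_pos hj)
      simp only [r, Set.indicator_of_mem hj]
      exact this
    · have := hloc (fun _ => 0) (fun _ => 0) fT (fun _ => 0) j rfl (if_neg hj)
      have h0 : D (fun _ => 0) (fun _ => 0) j = 0 := rhoP_self hp _ _ _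
      simp only [r, Set.indicator_of_notMem hj]
      rwa [h0] at this
  have hfin : Summable fun j => D (fun _ => 0) fT j ^ p := by
    refine Summable.of_norm_bounded_eventually_nat hr ?_
    filter_upwards [hr.tendsto_atTop_zero.eventually (gt_mem_nhds one_pos)] with j hj
    rw [Real.norm_of_nonneg (Real.rpow_nonneg (hD0 _ _ _) _)]
    have h1 := hDr j
    have h2 := Real.rpow_le_rpow_of_exponent_ge' (hD0 (fun _ => 0) fT j) (by linarith)
      zero_le_one hp
    rw [Real.rpow_one] at h2
    linarith
  rw [← hrel] at hfin
  have hlim := hfin.comp hφ.tendsto_atTop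
  have hone : Tendsto (fun _ : ℕ => (1 : ℝ)) atTop (𝓝 0) := by
    refine hlim.congr fun k => ?_
    have h1 : fT (φ k) = N (φ k) := if_pos ⟨k, rfl⟩
    simp only [Function.comp, h1, min_self, Nat.zero_min, div_self (hNr (φ k)).ne']
    simp
  exact one_ne_zero (tendsto_nhds_unique tendsto_const_nhds hone)

theorem EXp_incomparable_c0 {X : Type*} [NormedAddCommGroup X] [NormedSpace ℝ X]
    [CompleteSpace X] [TopologicalSpace.SeparableSpace X] [MeasurableSpace X] [BorelSpace X]
    (hX : ∃ e : X, e ≠ 0) (p : ℝ) (hp : 1 ≤ p) :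
    ¬ BorelReducible
        (fun x y : ℕ → X => Summable fun n => ‖x n - y n‖ ^ p)
        (fun x y : ℕ → ℝ => Tendsto (fun n => |x n - y n|) atTop (𝓝 0)) ∧
    ¬ BorelReducible
        (fun x y : ℕ → ℝ => Tendsto (fun n => |x n - y n|) atTop (𝓝 0))
        (fun x y : ℕ → X => Summable fun n => ‖x n - y n‖ ^ p) := by
  constructor
  · rintro ⟨θ, hθ, hred⟩
    exact partA hX p hp θ hθ hred
  · rintro ⟨θ, hθ, hred⟩
    exact partB p hp θ hθ hred
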